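/- Let A ∈ ℂ^{N×L} have rank L, let S ∈ ℂ^{L×L} be Hermitian positive definite, let σ be a real number, and set R = A S Aᴴ + σ² I_N. Then for every vector v ∈ ℂ^N, one has R v = σ² v if and only if Aᴴ v = 0; that is, the eigenspace of R for the eigenvalue σ² equals the nullspace of Aᴴ. -/

import Mathlib

open ComplexOrder Matrix

theorem Matrix.PosDef.mul_mul_conjTranspose_mulVec_eq_zero_iff {m n : Type*} [Fintype m]
    [Fintype n] {S : Matrix n n ℂ} (hS : S.PosDef) (A : Matrix m n ℂ) (v : m → ℂ) :
    (A * S * Aᴴ) *ᵥ v = 0 ↔ Aᴴ *ᵥ v = 0 := by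
  refine ⟨fun h => ?_, fun h => by rw [← mulVec_mulVec, h, mulVec_zero]⟩
  by_contra hne
  have hform : star (Aᴴ *ᵥ v) ⬝ᵥ S *ᵥ (Aᴴ *ᵥ v) = star v ⬝ᵥ (A * S * Aᴴ) *ᵥ v := by
    rw [star_mulVec, conjTranspose_conjTranspose, ← dotProduct_mulVec, mulVec_mulVec,
      mulVec_mulVec, Matrix.mul_assoc]
  have hpos := hS.dotProduct_mulVec_pos hne
  rw [hform, h, dotProduct_zero] at hpos
  exact lt_irrefl _ hpos

/-- For A ∈ ℂ^{N×L} of rank L, S Hermitian positive definite and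
R = A S Aᴴ + σ² I, the σ²-eigenspace of R is exactly the nullspace of Aᴴ. -/
theorem stmt_16 (N L : ℕ) (A : Matrix (Fin N) (Fin L) ℂ) (hA : A.rank = L)
    (S : Matrix (Fin L) (Fin L) ℂ) (hS : S.PosDef) (σ : ℝ)
    (R : Matrix (Fin N) (Fin N) ℂ)
    (hR : R = A * S * Aᴴ + (σ ^ 2 : ℂ) • (1 : Matrix (Fin N) (Fin N) ℂ)) :
    ∀ v : Fin N → ℂ, R.mulVec v = (σ ^ 2 : ℂ) • v ↔ Aᴴ.mulVec v = 0 := by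
  intro v
  rw [hR, add_mulVec, smul_mulVec, one_mulVec, add_eq_right]
  exact hS.mul_mul_conjTranspose_mulVec_eq_zero_iff A v
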